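/- A positive measure μ₀ on E satisfies μ₀(gA) = c_g μ₀(A) for all measurable A (for some constant c_g > 0) if and only if its Laplace transform satisfies L_{μ₀}(g*θ) = c_g^{-1} L_{μ₀}(θ) for all θ in the interior of the finiteness domain of L_{μ₀}, where g* denotes the adjoint of g. -/

import Mathlib

open MeasureTheory RealInnerProductSpace

open ProbabilityTheory Filter Topology

lemma lapl_eqOn_strip {Ω : Type*} [MeasurableSpace Ω] {X : Ω → ℝ} (hX : Measurable X)
    {P Q : Measure Ω} {ε : ℝ} (hε : 0 < ε)
    (h1 : ∀ t ∈ Set.Ioo (-ε) ε, ∫⁻ x, ENNReal.ofReal (Real.exp (t * X x)) ∂P < ⊤)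
    (h2 : ∀ t ∈ Set.Ioo (-ε) ε, ∫⁻ x, ENNReal.ofReal (Real.exp (t * X x)) ∂P
      = ∫⁻ x, ENNReal.ofReal (Real.exp (t * X x)) ∂Q) :
    complexMGF X P Complex.I = complexMGF X Q Complex.I := by
  have key : ∀ κ : Measure Ω,
      (∀ t ∈ Set.Ioo (-ε) ε, ∫⁻ x, ENNReal.ofReal (Real.exp (t * X x)) ∂κ < ⊤) →
      AnalyticOnNhd ℂ (complexMGF X κ) {z : ℂ | z.re ∈ Set.Ioo (-ε) ε} := by
    intro κ hR
    refine analyticOnNhd_complexMGF.mono fun z hz => ?_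
    refine interior_mono (s := Set.Ioo (-ε) ε) ?_ (by rw [isOpen_Ioo.interior_eq]; exact hz)
    intro t ht
    refine ⟨by fun_prop, ?_⟩
    rw [hasFiniteIntegral_iff_ofReal (ae_of_all _ fun x => (Real.exp_pos _).le)]
    exact hR t ht
  have hP := key P h1
  have hQ := key Q (fun t ht => (h2 t ht) ▸ h1 t ht)
  have h0 : (0 : ℝ) ∈ Set.Ioo (-ε) ε := by constructor <;> linarith
  refine AnalyticOnNhd.eqOn_of_preconnected_of_frequently_eq hP hQ
    (((convex_Ioo (-ε) ε).linear_preimage Complex.reLm).isPreconnected)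
    (z₀ := ((0 : ℝ) : ℂ)) (by simpa using hε) ?_ (by simpa using hε)
  have h_real : ∃ᶠ (x : ℝ) in 𝓝[≠] 0, complexMGF X P x = complexMGF X Q x := by
    refine Eventually.frequently ?_
    filter_upwards [nhdsWithin_le_nhds (isOpen_Ioo.mem_nhds h0)] with y hy
    rw [complexMGF_ofReal, complexMGF_ofReal, mgf, mgf,
      integral_eq_lintegral_of_nonneg_ae (ae_of_all _ fun x => (Real.exp_pos _).le) (by fun_prop),
      integral_eq_lintegral_of_nonneg_ae (ae_of_all _ fun x => (Real.exp_pos _).le) (by fun_prop),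
      h2 y hy]
  rw [frequently_iff_seq_forall] at h_real ⊢
  obtain ⟨xs, hx_tendsto, hx_eq⟩ := h_real
  refine ⟨fun n ↦ xs n, ?_, fun n ↦ ?_⟩
  · rw [tendsto_nhdsWithin_iff] at hx_tendsto ⊢
    constructor
    · exact (Complex.continuous_ofReal.tendsto 0).comp hx_tendsto.1
    · simpa using hx_tendsto.2
  · simp [hx_eq]

lemma lapl_unique {E : Type*} [NormedAddCommGroup E]
    [InnerProductSpace ℝ E] [FiniteDimensional ℝ E] [MeasurableSpace E] [BorelSpace E]
    (μ ν : Measure E) (U : Set E) (hU : IsOpen U) (hne : U.Nonempty)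
    (h1 : ∀ θ ∈ U, ∫⁻ x, ENNReal.ofReal (Real.exp ⟪θ, x⟫) ∂μ < ⊤)
    (h2 : ∀ θ ∈ U, ∫⁻ x, ENNReal.ofReal (Real.exp ⟪θ, x⟫) ∂μ
      = ∫⁻ x, ENNReal.ofReal (Real.exp ⟪θ, x⟫) ∂ν) : μ = ν := by
  obtain ⟨θ, hθ⟩ := hne
  set f : E → ENNReal := fun x => ENNReal.ofReal (Real.exp ⟪θ, x⟫) with hf
  have hfm : Measurable f := by fun_prop
  have hf0 : ∀ x, f x ≠ 0 := fun x => by simp [hf, Real.exp_pos]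
  have hft : ∀ x, f x ≠ ⊤ := fun x => by simp [hf]
  suffices h : μ.withDensity f = ν.withDensity f by
    rw [← withDensity_inv_same (μ := μ) hfm (ae_of_all _ hf0) (ae_of_all _ hft), h,
      withDensity_inv_same (μ := ν) hfm (ae_of_all _ hf0) (ae_of_all _ hft)]
  have hPf : IsFiniteMeasure (μ.withDensity f) := isFiniteMeasure_withDensity (h1 θ hθ).ne
  have hQf : IsFiniteMeasure (ν.withDensity f) :=
    isFiniteMeasure_withDensity (h2 θ hθ ▸ h1 θ hθ).ne
  have hl : ∀ (κ : Measure E) (s : E) (t : ℝ),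
      ∫⁻ x, ENNReal.ofReal (Real.exp (t * ⟪x, s⟫)) ∂(κ.withDensity f)
        = ∫⁻ x, ENNReal.ofReal (Real.exp ⟪θ + t • s, x⟫) ∂κ := by
    intro κ s t
    rw [lintegral_withDensity_eq_lintegral_mul _ hfm (by fun_prop)]
    refine lintegral_congr fun x => ?_
    simp only [Pi.mul_apply, hf]
    rw [← ENNReal.ofReal_mul (Real.exp_pos _).le, ← Real.exp_add, inner_add_left,
      real_inner_smul_left, real_inner_comm x s]
  apply Measure.ext_of_charFun
  ext s
  have hmem : ∀ᶠ t : ℝ in 𝓝 0, θ + t • s ∈ U := by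
    have hc : Continuous fun t : ℝ => θ + t • s := by fun_prop
    exact hc.continuousAt.eventually_mem (hU.mem_nhds (by simpa using hθ))
  obtain ⟨ε, hε, hball⟩ := Metric.eventually_nhds_iff_ball.1 hmem
  have := lapl_eqOn_strip (X := fun x : E => ⟪x, s⟫) (by fun_prop)
    (P := μ.withDensity f) (Q := ν.withDensity f) hε
    (fun t ht => by
      rw [hl]; exact h1 _ (hball t (by rw [Real.ball_eq_Ioo]; simpa using ht)))
    (fun t ht => by
      rw [hl, hl]; exact h2 _ (hball t (by rw [Real.ball_eq_Ioo]; simpa using ht)))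
  simpa only [complexMGF, charFun_apply, mul_comm Complex.I] using this

/-- A positive (Radon) measure `μ₀` with nonempty `Θ(μ₀)` satisfies
`μ₀(gA) = c · μ₀(A)` for all measurable `A` iff its Laplace transform satisfies
`L_{μ₀}(g*θ) = c⁻¹ L_{μ₀}(θ)` for all `θ ∈ Θ(μ₀)`, where `g*` is the adjoint of `g`. -/
theorem invariant_measure_iff_laplace {E : Type*} [NormedAddCommGroup E]
    [InnerProductSpace ℝ E] [FiniteDimensional ℝ E] [MeasurableSpace E] [BorelSpace E]
    (μ₀ : Measure E) [μ₀.Regular] (g : E ≃ₗ[ℝ] E) (gstar : E →ₗ[ℝ] E)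
    (hadj : ∀ θ x : E, ⟪gstar θ, x⟫ = ⟪θ, g x⟫) (c : ℝ) (hc : 0 < c)
    (hdom : (interior {θ : E | ∫⁻ x, ENNReal.ofReal (Real.exp ⟪θ, x⟫) ∂μ₀ < ⊤}).Nonempty) :
    (∀ A : Set E, MeasurableSet A → μ₀ (g '' A) = ENNReal.ofReal c * μ₀ A) ↔
      (∀ θ ∈ interior {θ : E | ∫⁻ x, ENNReal.ofReal (Real.exp ⟪θ, x⟫) ∂μ₀ < ⊤},
        ∫⁻ x, ENNReal.ofReal (Real.exp ⟪gstar θ, x⟫) ∂μ₀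
          = ENNReal.ofReal c⁻¹ * ∫⁻ x, ENNReal.ofReal (Real.exp ⟪θ, x⟫) ∂μ₀) := by
  have hgm : Measurable g := (LinearMap.continuous_of_finiteDimensional g.toLinearMap).measurable
  have hgsm : Measurable g.symm :=
    (LinearMap.continuous_of_finiteDimensional g.symm.toLinearMap).measurable
  have hc0 : ENNReal.ofReal c ≠ 0 := by simpa using hc
  have hinv : ENNReal.ofReal c⁻¹ * ENNReal.ofReal c = 1 := by
    rw [← ENNReal.ofReal_mul (by positivity), inv_mul_cancel₀ hc.ne', ENNReal.ofReal_one]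
  have himg : ∀ A : Set E, g '' A = g.symm ⁻¹' A := fun A => g.toEquiv.image_eq_preimage_symm A
  have hL : ∀ θ, ∫⁻ x, ENNReal.ofReal (Real.exp ⟪gstar θ, x⟫) ∂μ₀
      = ∫⁻ x, ENNReal.ofReal (Real.exp ⟪θ, x⟫) ∂(μ₀.map g) := by
    intro θ
    rw [lintegral_map (by fun_prop) hgm]
    simp only [hadj]
  have hmeas : (∀ A : Set E, MeasurableSet A → μ₀ (g '' A) = ENNReal.ofReal c * μ₀ A) ↔
      ENNReal.ofReal c⁻¹ • μ₀ = μ₀.map g := by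
    constructor
    · intro h
      ext B hB
      have h' := h (g ⁻¹' B) (hgm hB)
      rw [Set.image_preimage_eq _ g.surjective] at h'
      rw [Measure.map_apply hgm hB, Measure.smul_apply, smul_eq_mul, h', ← mul_assoc, hinv,
        one_mul]
    · intro h A hA
      have hB : MeasurableSet (g '' A) := by rw [himg]; exact hgsm hA
      have h' := congrArg (fun m : Measure E => m (g '' A)) h
      simp only [Measure.map_apply hgm hB, Measure.smul_apply, smul_eq_mul,
        Set.preimage_image_eq _ g.injective] at h'
      rw [← h', ← mul_assoc, mul_comm (ENNReal.ofReal c), hinv, one_mul]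
  rw [hmeas]
  constructor
  · intro h θ _
    rw [hL, ← h, lintegral_smul_measure, smul_eq_mul]
  · intro h
    refine lapl_unique _ _ _ isOpen_interior hdom (fun θ hθ => ?_) (fun θ hθ => ?_)
    · rw [lintegral_smul_measure, smul_eq_mul]
      have hθ2 := interior_subset hθ
      exact ENNReal.mul_lt_top ENNReal.ofReal_lt_top hθ2
    · rw [lintegral_smul_measure, smul_eq_mul, ← hL, h θ hθ]
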